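/- Assume additionally that there exist constants C₁ > 0, K > 0, α ∈ [0,1) and a natural number N₀ ≥ 1 such that |A|_∞(x) + |C|_∞(x)² · Φ_A(x)⁻¹ + ‖B̄(x)‖² ≤ C₁ ‖x‖^{2α} for Lebesgue-a.e. x with ‖x‖ > N₀. Let h : ℝ^d → ℝ be a bounded C¹ function satisfying the weak resolvent identity. Then for every integer n ≥ N₀ and every compactly supported Lipschitz function u : ℝ^d → [0,1] with u = 1 on B_n, u = 0 outside B_{2n}, and ‖∇u(x)‖ ≤ K/n for a.e. x, one has ∫_{B_n} h² dμ ≤ ( 2^{2α+1} C₁ K² (d + d²) + 2^α √C₁ K ) · n^{α−1} · ∫_{B_{2n}} h² dμ. -/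

import Mathlib

open MeasureTheory Real
open scoped RealInnerProductSpace ENNReal

noncomputable section

/-- `⟨M v, w⟩` for a `d × d` matrix `M` and vectors `v, w ∈ ℝ^d`. -/
def mdot {d : ℕ} (M : Matrix (Fin d) (Fin d) ℝ) (v w : EuclideanSpace ℝ (Fin d)) : ℝ :=
  ∑ i, ∑ j, M i j * v j * w i

/-- `|M|_∞ = max_{i,j} |m_ij|`. -/
def matSup {d : ℕ} (M : Matrix (Fin d) (Fin d) ℝ) : ℝ :=
  ⨆ i, ⨆ j, |M i j|

/-- `Φ_M = inf_{ξ ≠ 0} ⟨M ξ, ξ⟩ / ‖ξ‖²`. -/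
def PhiA {d : ℕ} (M : Matrix (Fin d) (Fin d) ℝ) : ℝ :=
  ⨅ ξ : {ξ : EuclideanSpace ℝ (Fin d) // ξ ≠ 0}, mdot M ξ.1 ξ.1 / ‖ξ.1‖ ^ 2

/-- `h` satisfies the weak resolvent identity:
`(1/2)∫ ⟨(A+C)∇u, ∇h⟩ dμ + ∫ ⟨B̄, ∇u⟩ h dμ + ∫ u h dμ = 0` for every compactly supported
Lipschitz `u`. -/
def WeakResolvent {d : ℕ} (μ : Measure (EuclideanSpace ℝ (Fin d)))
    (A C : EuclideanSpace ℝ (Fin d) → Matrix (Fin d) (Fin d) ℝ)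
    (Bb : EuclideanSpace ℝ (Fin d) → EuclideanSpace ℝ (Fin d))
    (h : EuclideanSpace ℝ (Fin d) → ℝ) : Prop :=
  ∀ u : EuclideanSpace ℝ (Fin d) → ℝ,
    (∃ K, LipschitzWith K u) → HasCompactSupport u →
    (1/2) * (∫ x, mdot (A x + C x) (gradient u x) (gradient h x) ∂μ)
      + (∫ x, ⟪Bb x, gradient u x⟫ * h x ∂μ)
      + (∫ x, u x * h x ∂μ) = 0



section MatrixEstimates

variable {d : ℕ}

theorem mdot_add_left (M N : Matrix (Fin d) (Fin d) ℝ) (v w : EuclideanSpace ℝ (Fin d)) :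
    mdot (M + N) v w = mdot M v w + mdot N v w := by
  simp only [mdot, ← Finset.sum_add_distrib, Matrix.add_apply, add_mul]

theorem mdot_smul_add (M : Matrix (Fin d) (Fin d) ℝ) (a b : ℝ)
    (v w z : EuclideanSpace ℝ (Fin d)) :
    mdot M (a • v + b • w) z = a * mdot M v z + b * mdot M w z := by
  simp only [mdot, Finset.mul_sum, ← Finset.sum_add_distrib]
  refine Finset.sum_congr rfl fun i _ => Finset.sum_congr rfl fun j _ => ?_
  simp only [PiLp.add_apply, PiLp.smul_apply, smul_eq_mul]
  ring

theorem mdot_transpose (M : Matrix (Fin d) (Fin d) ℝ) (v w : EuclideanSpace ℝ (Fin d)) :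
    mdot M.transpose v w = mdot M w v := by
  simp only [mdot, Matrix.transpose_apply]
  rw [Finset.sum_comm]
  refine Finset.sum_congr rfl fun i _ => Finset.sum_congr rfl fun j _ => ?_
  ring

theorem mdot_neg_left (M : Matrix (Fin d) (Fin d) ℝ) (v w : EuclideanSpace ℝ (Fin d)) :
    mdot (-M) v w = -mdot M v w := by
  simp [mdot, Finset.sum_neg_distrib]

theorem mdot_self_of_antisymm {M : Matrix (Fin d) (Fin d) ℝ} (hM : M.transpose = -M)
    (v : EuclideanSpace ℝ (Fin d)) : mdot M v v = 0 := by
  have h := mdot_transpose M v v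
  rw [hM, mdot_neg_left] at h
  linarith

theorem abs_entry_le_matSup (M : Matrix (Fin d) (Fin d) ℝ) (i j : Fin d) :
    |M i j| ≤ matSup M :=
  (le_ciSup (f := fun j => |M i j|) (Set.finite_range _).bddAbove j).trans
    (le_ciSup (f := fun i => ⨆ j, |M i j|) (Set.finite_range _).bddAbove i)

theorem matSup_nonneg (M : Matrix (Fin d) (Fin d) ℝ) : 0 ≤ matSup M :=
  Real.iSup_nonneg fun _ => Real.iSup_nonneg fun _ => abs_nonneg _

theorem sum_abs_le_sqrt_mul_norm (v : EuclideanSpace ℝ (Fin d)) :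
    ∑ i, |v i| ≤ √d * ‖v‖ := by
  have h := sq_sum_le_card_mul_sum_sq (s := Finset.univ) (f := fun i => |v i|)
  rw [EuclideanSpace.norm_eq, ← Real.sqrt_mul (Nat.cast_nonneg d)]
  refine Real.le_sqrt_of_sq_le ?_
  simpa using h

theorem abs_mdot_le (M : Matrix (Fin d) (Fin d) ℝ) (v w : EuclideanSpace ℝ (Fin d)) :
    |mdot M v w| ≤ d * matSup M * (‖v‖ * ‖w‖) := by
  have h1 : |mdot M v w| ≤ matSup M * ((∑ j, |v j|) * ∑ i, |w i|) := by
    rw [mul_comm (∑ j, |v j|), Finset.sum_mul_sum, Finset.mul_sum]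
    refine (Finset.abs_sum_le_sum_abs _ _).trans (Finset.sum_le_sum fun i _ => ?_)
    rw [Finset.mul_sum]
    refine (Finset.abs_sum_le_sum_abs _ _).trans (Finset.sum_le_sum fun j _ => ?_)
    rw [abs_mul, abs_mul, mul_assoc, mul_comm |w i|]
    exact mul_le_mul_of_nonneg_right (abs_entry_le_matSup M i j) (by positivity)
  have h2 : (∑ j, |v j|) * ∑ i, |w i| ≤ (√d * ‖v‖) * (√d * ‖w‖) :=
    mul_le_mul (sum_abs_le_sqrt_mul_norm v) (sum_abs_le_sqrt_mul_norm w)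
      (Finset.sum_nonneg fun _ _ => abs_nonneg _) (by positivity)
  have h3 : (√d * ‖v‖) * (√d * ‖w‖) = d * (‖v‖ * ‖w‖) := by
    rw [mul_mul_mul_comm, Real.mul_self_sqrt (Nat.cast_nonneg d)]
  calc |mdot M v w| ≤ matSup M * (d * (‖v‖ * ‖w‖)) :=
        h1.trans (mul_le_mul_of_nonneg_left (h2.trans h3.le) (matSup_nonneg M))
    _ = _ := by ring

theorem mdot_self_pos {M : Matrix (Fin d) (Fin d) ℝ} (hM : M.PosDef)
    {v : EuclideanSpace ℝ (Fin d)} (hv : v ≠ 0) : 0 < mdot M v v := by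
  have hv' : v.ofLp ≠ 0 := fun h => hv (WithLp.ofLp_injective 2 h)
  have h := hM.dotProduct_mulVec_pos hv'
  simp only [dotProduct, Matrix.mulVec, Finset.mul_sum, star_trivial] at h
  refine h.trans_eq ?_
  unfold mdot
  refine Finset.sum_congr rfl fun i _ => Finset.sum_congr rfl fun j _ => ?_
  ring

theorem mdot_self_nonneg {M : Matrix (Fin d) (Fin d) ℝ} (hM : M.PosDef)
    (v : EuclideanSpace ℝ (Fin d)) : 0 ≤ mdot M v v := by
  rcases eq_or_ne v 0 with rfl | hv
  · simp [mdot]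
  · exact (mdot_self_pos hM hv).le

theorem PhiA_mul_norm_sq_le {M : Matrix (Fin d) (Fin d) ℝ} (hM : M.PosDef)
    (v : EuclideanSpace ℝ (Fin d)) : PhiA M * ‖v‖ ^ 2 ≤ mdot M v v := by
  rcases eq_or_ne v 0 with rfl | hv
  · simp [mdot]
  · rw [← le_div_iff₀ (by positivity)]
    refine ciInf_le (f := fun ξ : {ξ : EuclideanSpace ℝ (Fin d) // ξ ≠ 0} =>
      mdot M ξ.1 ξ.1 / ‖ξ.1‖ ^ 2) ⟨0, ?_⟩ ⟨v, hv⟩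
    rintro _ ⟨ξ, rfl⟩
    exact div_nonneg (mdot_self_nonneg hM _) (by positivity)

theorem continuous_mdot_self (M : Matrix (Fin d) (Fin d) ℝ) :
    Continuous fun v => mdot M v v := by
  unfold mdot
  fun_prop

theorem PhiA_pos (hd : 0 < d) {M : Matrix (Fin d) (Fin d) ℝ} (hM : M.PosDef) : 0 < PhiA M := by
  have : Nonempty (Fin d) := ⟨⟨0, hd⟩⟩
  obtain ⟨e, he⟩ := exists_ne (0 : EuclideanSpace ℝ (Fin d))
  obtain ⟨m, hm, hmin⟩ := (isCompact_sphere (0 : EuclideanSpace ℝ (Fin d)) 1).exists_isMinOn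
    (NormedSpace.sphere_nonempty.2 zero_le_one) (continuous_mdot_self M).continuousOn
  have hm0 : m ≠ 0 := by
    rintro rfl
    simp at hm
  have : Nonempty {ξ : EuclideanSpace ℝ (Fin d) // ξ ≠ 0} := ⟨⟨e, he⟩⟩
  refine (mdot_self_pos hM hm0).trans_le (le_ciInf fun ξ => ?_)
  have hξ : ‖ξ.1‖ ≠ 0 := norm_ne_zero_iff.2 ξ.2
  have hs : ‖ξ.1‖⁻¹ • ξ.1 ∈ Metric.sphere (0 : EuclideanSpace ℝ (Fin d)) 1 := by
    simp [norm_smul, hξ]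
  refine (isMinOn_iff.1 hmin _ hs).trans_eq ?_
  simp only [mdot, PiLp.smul_apply, smul_eq_mul, Finset.sum_div]
  refine Finset.sum_congr rfl fun i _ => Finset.sum_congr rfl fun j _ => ?_
  field_simp

theorem neg_mul_mdot_le_of_posDef {M : Matrix (Fin d) (Fin d) ℝ} (hsymm : M.IsSymm)
    (hM : M.PosDef) (s t : ℝ) (p q : EuclideanSpace ℝ (Fin d)) :
    -(s * t * mdot M p q) ≤ s ^ 2 / 4 * mdot M q q + t ^ 2 * mdot M p p := by
  have hswap (v w : EuclideanSpace ℝ (Fin d)) : mdot M v w = mdot M w v := by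
    rw [← mdot_transpose, hsymm.eq]
  have h := mdot_self_nonneg hM ((s / 2) • q + t • p)
  rw [mdot_smul_add, hswap q, hswap p, mdot_smul_add, mdot_smul_add, hswap q p] at h
  nlinarith

theorem neg_mul_mdot_le_of_norm_sq_le {N : Matrix (Fin d) (Fin d) ℝ} {Φ m : ℝ} (hΦ : 0 < Φ)
    (s t : ℝ) (p q : EuclideanSpace ℝ (Fin d)) (hq : Φ * ‖q‖ ^ 2 ≤ m) :
    -(s * t * mdot N p q) ≤
      s ^ 2 / 4 * m + t ^ 2 * (d ^ 2 * (matSup N ^ 2 * Φ⁻¹) * ‖p‖ ^ 2) := by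
  have h1 : -(s * t * mdot N p q) ≤ |s| * |t| * (d * matSup N * (‖p‖ * ‖q‖)) := by
    refine (neg_le_abs _).trans ?_
    rw [abs_mul, abs_mul]
    exact mul_le_mul_of_nonneg_left (abs_mdot_le N p q) (by positivity)
  have h2 : |s| * |t| * (d * matSup N * (‖p‖ * ‖q‖)) ≤
      |s| ^ 2 / 4 * (Φ * ‖q‖ ^ 2) + |t| ^ 2 * (d ^ 2 * (matSup N ^ 2 * Φ⁻¹) * ‖p‖ ^ 2) := by
    have hsq := mul_nonneg (inv_nonneg.2 hΦ.le)
      (sq_nonneg (|s| / 2 * Φ * ‖q‖ - |t| * d * matSup N * ‖p‖))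
    have key : |s| ^ 2 / 4 * (Φ * ‖q‖ ^ 2) + |t| ^ 2 * (d ^ 2 * (matSup N ^ 2 * Φ⁻¹) * ‖p‖ ^ 2)
        - |s| * |t| * (d * matSup N * (‖p‖ * ‖q‖)) =
        Φ⁻¹ * (|s| / 2 * Φ * ‖q‖ - |t| * d * matSup N * ‖p‖) ^ 2 := by
      field_simp
      ring
    linarith
  have h3 : |s| ^ 2 / 4 * (Φ * ‖q‖ ^ 2) ≤ s ^ 2 / 4 * m := by
    rw [sq_abs]
    exact mul_le_mul_of_nonneg_left hq (by positivity)
  rw [sq_abs t] at h2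
  linarith

/-- The pointwise absorption estimate behind the energy inequality. -/
theorem neg_energy_le (hd : 0 < d) {M N : Matrix (Fin d) (Fin d) ℝ} (hsymm : M.IsSymm)
    (hM : M.PosDef) (s t : ℝ) (p q : EuclideanSpace ℝ (Fin d)) :
    -(s ^ 2 / 2 * mdot M q q + s * t * mdot (M + N) p q) ≤
      t ^ 2 * ‖p‖ ^ 2 * (d * matSup M + d ^ 2 * (matSup N ^ 2 * (PhiA M)⁻¹)) := by
  have h1 := neg_mul_mdot_le_of_posDef hsymm hM s t p q
  have h2 := neg_mul_mdot_le_of_norm_sq_le (N := N) (PhiA_pos hd hM) s t p q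
    (PhiA_mul_norm_sq_le hM q)
  have h3 := mul_le_mul_of_nonneg_left ((le_abs_self _).trans (abs_mdot_le M p p)) (sq_nonneg t)
  rw [mdot_add_left]
  linarith

end MatrixEstimates

section Gradient

variable {d : ℕ}

theorem gradient_mul {f g : EuclideanSpace ℝ (Fin d) → ℝ} {x : EuclideanSpace ℝ (Fin d)}
    (hf : DifferentiableAt ℝ f x) (hg : DifferentiableAt ℝ g x) :
    gradient (fun y => f y * g y) x = g x • gradient f x + f x • gradient g x := by
  simp only [gradient, fderiv_fun_mul hf hg, map_add, map_smul]
  rw [add_comm]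

theorem gradient_fun_sq {f : EuclideanSpace ℝ (Fin d) → ℝ} {x : EuclideanSpace ℝ (Fin d)}
    (hf : DifferentiableAt ℝ f x) :
    gradient (fun y => f y ^ 2) x = (2 * f x) • gradient f x := by
  simp only [sq]
  rw [gradient_mul hf hf, ← add_smul, two_mul]

theorem measurable_gradient_apply (f : EuclideanSpace ℝ (Fin d) → ℝ) (j : Fin d) :
    Measurable fun x => gradient f x j := by
  have h : Measurable (gradient f) :=
    (LinearIsometryEquiv.continuous _).measurable.comp (measurable_fderiv ℝ f)
  exact ((EuclideanSpace.proj j : EuclideanSpace ℝ (Fin d) →L[ℝ] ℝ).continuous.measurable).comp h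

theorem continuous_gradient {f : EuclideanSpace ℝ (Fin d) → ℝ} (hf : ContDiff ℝ 1 f) :
    Continuous (gradient f) :=
  (LinearIsometryEquiv.continuous _).comp (hf.continuous_fderiv one_ne_zero)

theorem norm_gradient_le_of_lipschitzWith {f : EuclideanSpace ℝ (Fin d) → ℝ} {L : NNReal}
    (hf : LipschitzWith L f) (x : EuclideanSpace ℝ (Fin d)) : ‖gradient f x‖ ≤ L := by
  rw [gradient, LinearIsometryEquiv.norm_map]
  exact norm_fderiv_le_of_lipschitz ℝ hf

theorem gradient_eq_zero_of_notMem_tsupport {f : EuclideanSpace ℝ (Fin d) → ℝ}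
    {x : EuclideanSpace ℝ (Fin d)} (hx : x ∉ tsupport f) : gradient f x = 0 := by
  rw [gradient, fderiv_of_notMem_tsupport ℝ hx, map_zero]

theorem integrable_mul_gradient_apply {μ : Measure (EuclideanSpace ℝ (Fin d))}
    {f g : EuclideanSpace ℝ (Fin d) → ℝ} (hf : ∃ L, LipschitzWith L f)
    (hfc : HasCompactSupport f) (hg : LocallyIntegrable g μ) (j : Fin d) :
    Integrable (fun x => g x * gradient f x j) μ := by
  obtain ⟨L, hL⟩ := hf
  have hon : IntegrableOn (fun x => g x * gradient f x j) (tsupport f) μ :=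
    Integrable.mul_bdd (c := L) (hg.integrableOn_isCompact hfc)
      (measurable_gradient_apply f j).aestronglyMeasurable
      (Filter.Eventually.of_forall fun x =>
        (PiLp.norm_apply_le _ j).trans (norm_gradient_le_of_lipschitzWith hL x))
  refine (integrableOn_iff_integrable_of_support_subset fun x hx => ?_).1 hon
  by_contra hx'
  exact hx (by simp [gradient_eq_zero_of_notMem_tsupport hx'])

theorem integrable_mdot_gradient {μ : Measure (EuclideanSpace ℝ (Fin d))}
    [IsLocallyFiniteMeasure μ] {M : EuclideanSpace ℝ (Fin d) → Matrix (Fin d) (Fin d) ℝ}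
    (hM : ∀ i j, Continuous fun x => M x i j) {f h : EuclideanSpace ℝ (Fin d) → ℝ}
    (hf : ∃ L, LipschitzWith L f) (hfc : HasCompactSupport f) (hh : ContDiff ℝ 1 h) :
    Integrable (fun x => mdot (M x) (gradient f x) (gradient h x)) μ := by
  refine integrable_finsetSum _ fun i _ => integrable_finsetSum _ fun j _ => ?_
  have hhc : Continuous fun x => gradient h x i :=
    (EuclideanSpace.proj i : EuclideanSpace ℝ (Fin d) →L[ℝ] ℝ).continuous.comp
      (continuous_gradient hh)
  refine (integrable_mul_gradient_apply hf hfc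
    (((hM i j).mul hhc).locallyIntegrable (μ := μ)) j).congr
    (Filter.Eventually.of_forall fun x => ?_)
  simp only [Pi.mul_apply]
  ring

theorem integrable_inner_gradient_mul {μ : Measure (EuclideanSpace ℝ (Fin d))}
    {B : EuclideanSpace ℝ (Fin d) → EuclideanSpace ℝ (Fin d)} (hB : Measurable B)
    (hBloc : LocallyIntegrable (fun x => ‖B x‖) μ) {f h : EuclideanSpace ℝ (Fin d) → ℝ}
    (hf : ∃ L, LipschitzWith L f) (hfc : HasCompactSupport f) (hh : Continuous h) :
    Integrable (fun x => ⟪B x, gradient f x⟫ * h x) μ := by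
  have hcoord (j : Fin d) : LocallyIntegrable (fun x => B x j * h x) μ := by
    have hBj : LocallyIntegrable (fun x => B x j) μ :=
      hBloc.mono ((EuclideanSpace.proj j :
        EuclideanSpace ℝ (Fin d) →L[ℝ] ℝ).continuous.measurable.comp hB).aestronglyMeasurable
        (Filter.Eventually.of_forall fun x => by
          rw [norm_norm]
          exact PiLp.norm_apply_le _ j)
    exact hBj.mul_continuous hh
  refine (integrable_finsetSum Finset.univ fun j _ =>
    integrable_mul_gradient_apply hf hfc (hcoord j) j).congr
    (Filter.Eventually.of_forall fun x => ?_)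
  simp only [PiLp.inner_apply, Finset.sum_mul, RCLike.inner_apply, conj_trivial]
  refine Finset.sum_congr rfl fun j _ => ?_
  ring

theorem exists_lipschitzWith_mul {f g : EuclideanSpace ℝ (Fin d) → ℝ}
    (hf : ∃ L, LipschitzWith L f) (hfc : HasCompactSupport f) (hf1 : ∀ x, |f x| ≤ 1)
    (hg : ContDiff ℝ 1 g) : ∃ L, LipschitzWith L fun x => f x * g x := by
  obtain ⟨L, hL⟩ := hf
  obtain ⟨R, hR⟩ := hfc.isCompact.isBounded.subset_closedBall 0
  have hcpt := isCompact_closedBall (0 : EuclideanSpace ℝ (Fin d)) R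
  obtain ⟨L', hL'⟩ := hg.contDiffOn.exists_lipschitzOnWith one_ne_zero
    (convex_closedBall (0 : EuclideanSpace ℝ (Fin d)) R) hcpt
  obtain ⟨m, hm⟩ := hcpt.exists_bound_of_continuousOn hg.continuous.continuousOn
  have hzero (x) (hx : x ∉ Metric.closedBall (0 : EuclideanSpace ℝ (Fin d)) R) : f x = 0 :=
    image_eq_zero_of_notMem_tsupport fun h => hx (hR h)
  have hmm (x) (hx : x ∈ Metric.closedBall (0 : EuclideanSpace ℝ (Fin d)) R) :
      |g x| ≤ m.toNNReal := (hm x hx).trans (Real.le_coe_toNNReal m)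
  refine ⟨L' + L * m.toNNReal, LipschitzWith.of_dist_le_mul fun x y => ?_⟩
  have hfd : |f x - f y| ≤ L * dist x y := hL.dist_le_mul x y
  rw [Real.dist_eq]
  push_cast
  by_cases hy : y ∈ Metric.closedBall (0 : EuclideanSpace ℝ (Fin d)) R
  · have h2 : |f x - f y| * |g y| ≤ L * dist x y * m.toNNReal :=
      mul_le_mul hfd (hmm y hy) (abs_nonneg _) (by positivity)
    by_cases hx : x ∈ Metric.closedBall (0 : EuclideanSpace ℝ (Fin d)) R
    · have h1 : |f x| * |g x - g y| ≤ 1 * (L' * dist x y) :=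
        mul_le_mul (hf1 x) (hL'.dist_le_mul x hx y hy) (abs_nonneg _) zero_le_one
      calc |f x * g x - f y * g y| = |f x * (g x - g y) + (f x - f y) * g y| := by ring_nf
        _ ≤ |f x| * |g x - g y| + |f x - f y| * |g y| := by
            rw [← abs_mul, ← abs_mul]
            exact abs_add_le _ _
        _ ≤ _ := by linarith
    · have h3 : (0 : ℝ) ≤ L' * dist x y := by positivity
      calc |f x * g x - f y * g y| = |f x - f y| * |g y| := by
            rw [← abs_mul, hzero x hx]
            ring_nf
        _ ≤ _ := by linarith
  · by_cases hx : x ∈ Metric.closedBall (0 : EuclideanSpace ℝ (Fin d)) R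
    · have h2 : |f x - f y| * |g x| ≤ L * dist x y * m.toNNReal :=
        mul_le_mul hfd (hmm x hx) (abs_nonneg _) (by positivity)
      have h3 : (0 : ℝ) ≤ L' * dist x y := by positivity
      calc |f x * g x - f y * g y| = |f x - f y| * |g x| := by
            rw [← abs_mul, hzero y hy]
            ring_nf
        _ ≤ _ := by linarith
    · rw [hzero x hx, hzero y hy]
      simp only [zero_mul, sub_zero, abs_zero]
      positivity

theorem exists_lipschitzWith_sq {f : EuclideanSpace ℝ (Fin d) → ℝ}
    (hf : ∃ L, LipschitzWith L f) (hf1 : ∀ x, |f x| ≤ 1) :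
    ∃ L, LipschitzWith L fun x => f x ^ 2 := by
  obtain ⟨L, hL⟩ := hf
  refine ⟨2 * L, LipschitzWith.of_dist_le_mul fun x y => ?_⟩
  have h1 : |f x + f y| ≤ 2 := (abs_add_le _ _).trans (by linarith [hf1 x, hf1 y])
  have h2 : |f x - f y| ≤ L * dist x y := hL.dist_le_mul x y
  rw [Real.dist_eq, sq_sub_sq, abs_mul]
  push_cast
  rw [mul_assoc]
  exact mul_le_mul h1 h2 (abs_nonneg _) zero_le_two

/-- A function with values in `[0, 1]` has vanishing gradient wherever it equals `0` or `1`. -/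
theorem gradient_eq_zero_of_mem_Icc {u : EuclideanSpace ℝ (Fin d) → ℝ}
    (hu : ∀ x, 0 ≤ u x ∧ u x ≤ 1) {x : EuclideanSpace ℝ (Fin d)} (hx : u x = 0 ∨ u x = 1) :
    gradient u x = 0 := by
  have hext : IsLocalExtr u x := by
    rcases hx with hx | hx
    · exact Or.inl (Filter.Eventually.of_forall fun y => hx.trans_le (hu y).1)
    · exact Or.inr (Filter.Eventually.of_forall fun y => (hu y).2.trans_eq hx.symm)
  rw [gradient, hext.fderiv_eq_zero, map_zero]

end Gradient

theorem growth_bound {C₁ K α a κ b r P n D E : ℝ} (hC₁ : 0 < C₁) (hK : 0 < K) (hα0 : 0 ≤ α)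
    (hα1 : α < 1) (hn : 1 ≤ n) (ha : 0 ≤ a) (hκ : 0 ≤ κ) (hr0 : 0 ≤ r)
    (hr : r ≤ 2 * n) (hP0 : 0 ≤ P) (hP : P ≤ K / n) (hD : 0 ≤ D) (hE : 0 ≤ E)
    (hgrowth : a + κ + b ^ 2 ≤ C₁ * r ^ (2 * α)) :
    P ^ 2 * (D * a + E * κ) + b * P ≤
      ((2 : ℝ) ^ (2 * α + 1) * C₁ * K ^ 2 * (D + E) + (2 : ℝ) ^ α * √C₁ * K) * n ^ (α - 1) := by
  have hn0 : 0 < n := by linarith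
  have he : (2 : ℝ) ^ (2 * α + 1) = 2 * ((2 : ℝ) ^ α) ^ 2 := by
    rw [Real.rpow_add_one two_ne_zero, mul_comm 2 α, Real.rpow_mul zero_le_two, Real.rpow_two]
    ring
  have hnα : n ^ α = n ^ (α - 1) * n := by
    rw [← Real.rpow_add_one hn0.ne', sub_add_cancel]
  have ht1 : n ^ (α - 1) ≤ 1 := Real.rpow_le_one_of_one_le_of_nonpos hn (by linarith)
  have ht0 : 0 < n ^ (α - 1) := Real.rpow_pos_of_pos hn0 _
  have he0 : 0 < (2 : ℝ) ^ α := Real.rpow_pos_of_pos two_pos _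
  have hrα : r ^ (2 * α) ≤ ((2 : ℝ) ^ α * (n ^ (α - 1) * n)) ^ 2 := by
    calc r ^ (2 * α) ≤ (2 * n) ^ (2 * α) := Real.rpow_le_rpow hr0 hr (by linarith)
      _ = _ := by
        rw [mul_comm 2 α, Real.rpow_mul (by positivity), Real.rpow_two,
          Real.mul_rpow zero_le_two hn0.le, hnα]
  rw [he]
  generalize (2 : ℝ) ^ α = e at *
  generalize n ^ (α - 1) = t at *
  have hs0 := Real.sqrt_nonneg C₁
  have hs : √C₁ ^ 2 = C₁ := Real.sq_sqrt hC₁.le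
  have hS : a + κ + b ^ 2 ≤ C₁ * (e * (t * n)) ^ 2 :=
    hgrowth.trans (mul_le_mul_of_nonneg_left hrα hC₁.le)
  have hbS : b ≤ √C₁ * (e * (t * n)) := by
    refine abs_le_of_sq_le_sq' ?_ (by positivity) |>.2
    rw [mul_pow, hs]
    linarith
  have h1 : b * P ≤ e * √C₁ * K * t := by
    calc b * P ≤ √C₁ * (e * (t * n)) * (K / n) := mul_le_mul hbS hP hP0 (by positivity)
      _ = _ := by field_simp
  have h2 : D * a + E * κ ≤ (D + E) * (C₁ * (e * (t * n)) ^ 2) := by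
    have h3 := mul_le_mul_of_nonneg_left (show a ≤ C₁ * (e * (t * n)) ^ 2 by nlinarith) hD
    have h4 := mul_le_mul_of_nonneg_left (show κ ≤ C₁ * (e * (t * n)) ^ 2 by nlinarith) hE
    linarith
  have h3 : P ^ 2 * (D * a + E * κ) ≤ e ^ 2 * C₁ * K ^ 2 * (D + E) * t ^ 2 := by
    calc P ^ 2 * (D * a + E * κ) ≤ (K / n) ^ 2 * ((D + E) * (C₁ * (e * (t * n)) ^ 2)) :=
          mul_le_mul (pow_le_pow_left₀ hP0 hP 2) h2 (by positivity) (by positivity)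
      _ = _ := by field_simp
  have h4 : e ^ 2 * C₁ * K ^ 2 * (D + E) * t ^ 2 ≤ e ^ 2 * C₁ * K ^ 2 * (D + E) * (2 * t) :=
    mul_le_mul_of_nonneg_left (by nlinarith) (by positivity)
  linarith

/-- The key iteration inequality in the proof of Theorem 3.1(i): for cutoffs `u` adapted to
the annulus `B_{2n} \ B_n`,
`∫_{B_n} h² dμ ≤ (2^{2α+1} C₁ K² (d+d²) + 2^α √C₁ K) n^{α-1} ∫_{B_{2n}} h² dμ`. -/
theorem stmt8 {d : ℕ} (hd : 2 ≤ d)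
    (ρ : EuclideanSpace ℝ (Fin d) → ℝ) (hρc : Continuous ρ) (hρ : ∀ x, 0 < ρ x)
    (μ : Measure (EuclideanSpace ℝ (Fin d)))
    (hμ : μ = volume.withDensity fun x => ENNReal.ofReal (ρ x))
    (A C : EuclideanSpace ℝ (Fin d) → Matrix (Fin d) (Fin d) ℝ)
    (hAc : ∀ i j, Continuous fun x => A x i j)
    (hAsymm : ∀ x, (A x).IsSymm) (hApos : ∀ x, (A x).PosDef)
    (hCc : ∀ i j, Continuous fun x => C x i j)
    (hCanti : ∀ x, (C x).transpose = -(C x))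
    (Bb : EuclideanSpace ℝ (Fin d) → EuclideanSpace ℝ (Fin d))
    (hBmeas : Measurable Bb)
    (hBloc : LocallyIntegrable (fun x => ‖Bb x‖) μ)
    (hBdiv : ∀ f : EuclideanSpace ℝ (Fin d) → ℝ, (∃ K, LipschitzWith K f) →
      HasCompactSupport f → ∫ x, ⟪Bb x, gradient f x⟫ ∂μ = 0)
    (C₁ K : ℝ) (hC₁ : 0 < C₁) (hK : 0 < K)
    (α : ℝ) (hα0 : 0 ≤ α) (hα1 : α < 1) (N₀ : ℕ) (hN₀ : 1 ≤ N₀)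
    (hgrowth : ∀ᵐ x ∂(volume : Measure (EuclideanSpace ℝ (Fin d))),
      (N₀ : ℝ) < ‖x‖ →
        matSup (A x) + matSup (C x) ^ 2 * (PhiA (A x))⁻¹ + ‖Bb x‖ ^ 2 ≤ C₁ * ‖x‖ ^ (2 * α))
    (h : EuclideanSpace ℝ (Fin d) → ℝ) (hh1 : ContDiff ℝ 1 h)
    (hhb : ∃ M, ∀ x, |h x| ≤ M)
    (hres : WeakResolvent μ A C Bb h) :
    ∀ n : ℕ, N₀ ≤ n →
    ∀ u : EuclideanSpace ℝ (Fin d) → ℝ,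
      (∃ K', LipschitzWith K' u) → HasCompactSupport u →
      (∀ x, 0 ≤ u x ∧ u x ≤ 1) →
      (∀ x ∈ Metric.ball (0 : EuclideanSpace ℝ (Fin d)) (n : ℝ), u x = 1) →
      (∀ x ∉ Metric.ball (0 : EuclideanSpace ℝ (Fin d)) (2 * n : ℝ), u x = 0) →
      (∀ᵐ x ∂(volume : Measure (EuclideanSpace ℝ (Fin d))), ‖gradient u x‖ ≤ K / n) →
      ∫ x in Metric.ball (0 : EuclideanSpace ℝ (Fin d)) (n : ℝ), h x ^ 2 ∂μ
        ≤ ((2 : ℝ) ^ (2 * α + 1) * C₁ * K ^ 2 * ((d : ℝ) + (d : ℝ) ^ 2)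
              + (2 : ℝ) ^ α * Real.sqrt C₁ * K) * (n : ℝ) ^ (α - 1)
            * ∫ x in Metric.ball (0 : EuclideanSpace ℝ (Fin d)) (2 * n : ℝ), h x ^ 2 ∂μ := by
  intro n hn u huL huc hu01 hu1 hu0 huK
  have hd0 : 0 < d := by omega
  have hn1 : (1 : ℝ) ≤ n := by exact_mod_cast hN₀.trans hn
  have : IsLocallyFiniteMeasure μ := hμ ▸ IsLocallyFiniteMeasure.withDensity_ofReal hρc
  have hac : μ ≪ volume := hμ ▸ withDensity_absolutelyContinuous _ _
  have huabs : ∀ x, |u x| ≤ 1 := fun x => by rw [abs_of_nonneg (hu01 x).1]; exact (hu01 x).2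
  have husq : ∀ x, |u x ^ 2| ≤ 1 := fun x => by
    rw [abs_pow]
    exact pow_le_one₀ (abs_nonneg _) (huabs x)
  have hu2c : HasCompactSupport fun x => u x ^ 2 := huc.comp_left (g := (· ^ 2)) (by simp)
  have hu2L := exists_lipschitzWith_sq huL huabs
  have hh2 : ContDiff ℝ 1 fun x => h x ^ 2 := hh1.pow 2
  have hw1L := exists_lipschitzWith_mul hu2L hu2c husq hh1
  have hw2L := exists_lipschitzWith_mul hu2L hu2c husq hh2
  have hw1c : HasCompactSupport fun x => u x ^ 2 * h x := hu2c.mul_right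
  have hw2c : HasCompactSupport fun x => u x ^ 2 * h x ^ 2 := hu2c.mul_right
  have huC : Continuous u := huL.choose_spec.continuous
  have hhC : Continuous h := hh1.continuous
  have hAC : ∀ i j, Continuous fun x => (A x + C x) i j := fun i j => (hAc i j).add (hCc i j)
  have I1 := integrable_mdot_gradient (μ := μ) hAC hw1L hw1c hh1
  have I2 := integrable_inner_gradient_mul hBmeas hBloc hw1L hw1c hhC
  have I3 : Integrable (fun x => u x ^ 2 * h x * h x) μ :=
    Continuous.integrable_of_hasCompactSupport (by fun_prop) hw1c.mul_right
  have I4 : Integrable (fun x => ⟪Bb x, gradient (fun x => u x ^ 2 * h x ^ 2) x⟫) μ := by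
    simpa using integrable_inner_gradient_mul hBmeas hBloc hw2L hw2c
      (continuous_const (y := (1 : ℝ)))
  have E1 := hres _ hw1L hw1c
  have E2 := hBdiv _ hw2L hw2c
  have hsq : Continuous fun x => h x ^ 2 := hhC.pow 2
  have hball (r : ℝ) : IntegrableOn (fun x => h x ^ 2) (Metric.ball 0 r) μ :=
    (hsq.locallyIntegrable.integrableOn_isCompact (isCompact_closedBall 0 r)).mono_set
      Metric.ball_subset_closedBall
  have J1 := (hball n).integrable_indicator Metric.isOpen_ball.measurableSet
  have J2 := (hball (2 * n)).integrable_indicator Metric.isOpen_ball.measurableSet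
  set c := ((2 : ℝ) ^ (2 * α + 1) * C₁ * K ^ 2 * ((d : ℝ) + (d : ℝ) ^ 2)
    + (2 : ℝ) ^ α * Real.sqrt C₁ * K) * (n : ℝ) ^ (α - 1)
  have hc0 : 0 ≤ c := by positivity
  have hsphere : ∀ᵐ x ∂(volume : Measure (EuclideanSpace ℝ (Fin d))), ‖x‖ ≠ n := by
    have h0 := Measure.addHaar_sphere_of_ne_zero
      (volume : Measure (EuclideanSpace ℝ (Fin d))) 0 (r := n) (by positivity)
    filter_upwards [measure_eq_zero_iff_ae_notMem.1 h0] with x hx hx'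
    exact hx (by simpa using hx')
  have hpoint : ∀ᵐ x ∂μ, (Metric.ball 0 (n : ℝ)).indicator (fun x => h x ^ 2) x ≤
      (1/2 * mdot (A x + C x) (gradient (fun x => u x ^ 2 * h x) x) (gradient h x)
        + ⟪Bb x, gradient (fun x => u x ^ 2 * h x) x⟫ * h x + u x ^ 2 * h x * h x
        - 1/2 * ⟪Bb x, gradient (fun x => u x ^ 2 * h x ^ 2) x⟫)
      + c * (Metric.ball 0 (2 * n : ℝ)).indicator (fun x => h x ^ 2) x := by
    apply hac.ae_le
    filter_upwards [hgrowth, huK, hsphere, huL.choose_spec.ae_differentiableAt]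
      with x hxg hxK hxn hxd
    have hhd : DifferentiableAt ℝ h x := (hh1.differentiable one_ne_zero) x
    have hle : (Metric.ball 0 (n : ℝ)).indicator (fun x => h x ^ 2) x ≤ u x ^ 2 * h x ^ 2 := by
      by_cases hx : x ∈ Metric.ball (0 : EuclideanSpace ℝ (Fin d)) (n : ℝ)
      · simp [Set.indicator_of_mem hx, hu1 x hx]
      · rw [Set.indicator_of_notMem hx]
        positivity
    refine hle.trans ?_
    rw [gradient_mul (hxd.fun_pow 2) hhd, gradient_mul (hxd.fun_pow 2) (hhd.fun_pow 2),
      gradient_fun_sq hxd, gradient_fun_sq hhd, smul_smul, smul_smul, smul_smul, mdot_smul_add,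
      mdot_add_left (A x) (C x) (gradient h x), mdot_self_of_antisymm (hCanti x)]
    simp only [inner_add_right, real_inner_smul_right]
    have hen := neg_energy_le hd0 (N := C x) (hAsymm x) (hApos x) (u x) (h x)
      (gradient u x) (gradient h x)
    have hB : -(u x * ⟪Bb x, gradient u x⟫) ≤ ‖Bb x‖ * ‖gradient u x‖ := by
      refine (neg_le_abs _).trans ?_
      rw [abs_mul]
      exact (mul_le_of_le_one_left (abs_nonneg _) (huabs x)).trans (abs_real_inner_le_norm _ _)
    have hB' := mul_le_mul_of_nonneg_left hB (sq_nonneg (h x))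
    have hfin : ‖gradient u x‖ ^ 2 *
        (d * matSup (A x) + d ^ 2 * (matSup (C x) ^ 2 * (PhiA (A x))⁻¹))
        + ‖Bb x‖ * ‖gradient u x‖ ≤ c ∧ x ∈ Metric.ball 0 (2 * n : ℝ) ∨ gradient u x = 0 := by
      by_cases hp : u x = 0 ∨ u x = 1
      · exact Or.inr (gradient_eq_zero_of_mem_Icc hu01 hp)
      push Not at hp
      have hx2 : x ∈ Metric.ball (0 : EuclideanSpace ℝ (Fin d)) (2 * n : ℝ) :=
        not_imp_comm.1 (hu0 x) hp.1
      have hx1 : x ∉ Metric.ball (0 : EuclideanSpace ℝ (Fin d)) (n : ℝ) :=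
        fun hx => hp.2 (hu1 x hx)
      refine Or.inl ⟨?_, hx2⟩
      rw [mem_ball_zero_iff] at hx1 hx2
      have hlt : (n : ℝ) < ‖x‖ := lt_of_le_of_ne (not_lt.1 hx1) hxn.symm
      have hN : (N₀ : ℝ) ≤ n := by exact_mod_cast hn
      exact growth_bound hC₁ hK hα0 hα1 hn1 (matSup_nonneg _)
        (mul_nonneg (sq_nonneg _) (inv_nonneg.2 (PhiA_pos hd0 (hApos x)).le))
        (norm_nonneg x) hx2.le (norm_nonneg _) hxK (by positivity)
        (by positivity) (hxg (hN.trans_lt hlt))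
    rcases hfin with ⟨hfin, hx2⟩ | hp
    · rw [Set.indicator_of_mem hx2]
      have := mul_le_mul_of_nonneg_left hfin (sq_nonneg (h x))
      linarith
    · have hind : 0 ≤ c * (Metric.ball 0 (2 * n : ℝ)).indicator (fun x => h x ^ 2) x :=
        mul_nonneg hc0 (Set.indicator_nonneg (fun _ _ => sq_nonneg _) _)
      rw [hp] at hen hB' ⊢
      simp only [norm_zero, inner_zero_right] at hen hB' ⊢
      linarith
  have S1 := I1.const_mul (1/2)
  have S2 := S1.add I2
  have S3 := S2.add I3
  have S4 := I4.const_mul (1/2)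
  have S5 := S3.sub S4
  have S6 := J2.const_mul c
  have hint := integral_mono_ae J1 (S5.add S6) hpoint
  rw [integral_add' S5 S6, integral_sub' S3 S4, integral_add' S2 I3, integral_add' S1 I2,
    integral_const_mul, integral_const_mul, integral_const_mul, E1, E2,
    integral_indicator Metric.isOpen_ball.measurableSet,
    integral_indicator Metric.isOpen_ball.measurableSet] at hint
  linarith
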